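/- arXiv:math/0210094 — 3 statements merged into one kernel-verified Lean document; each statement's English description precedes it below -/
import Mathlib

section
/- Let K be a field of characteristic zero, let F = X₁X₂X₃ and G = X₁³ + X₂³ + X₃³ in K[X₁, X₂, X₃], and let R be the K-subalgebra of K[X₁, X₂, X₃] generated by X₁F, X₂F, X₃F, X₁G, X₂G, X₃G. Then there exists a positive integer N such that for all n ≥ N, the K-vector space consisting of those elements of R that are homogeneous polynomials of degree 4n in K[X₁, X₂, X₃] has dimension 3n(n+1) + (n−1)(n−2)/2. -/
open MvPolynomial

set_option synthInstance.maxHeartbeats 800000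

namespace MvPolynomial

/-- The number of monomials of degree `n` in `#σ` variables is the dimension of the space of forms
of degree `n`. -/
theorem finrank_homogeneousSubmodule (σ K : Type*) [Fintype σ] [Field K] (n : ℕ) :
    Module.finrank K (homogeneousSubmodule σ K n) = (Fintype.card σ + n - 1).choose n := by
  classical
  have h : homogeneousSubmodule σ K n = restrictSupport K {d : σ →₀ ℕ | d.degree = n} :=
    homogeneousSubmodule_eq_finsupp_supported σ K n
  have hs : {d : σ →₀ ℕ | d.degree = n} = (Finset.univ : Finset σ).finsuppAntidiag n := by
    ext d
    simp [Finsupp.degree_eq_sum]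
  rw [h, Module.finrank_eq_nat_card_basis (basisRestrictSupport K _), hs, Nat.card_coe_set_eq,
    Set.ncard_coe_finset, Finset.card_finsuppAntidiag_nat_eq_choose, Finset.card_univ]

section PowSpanPair

variable {σ K : Type*} [Field K] {F G : MvPolynomial σ K}

theorem span_pair_pow_succ (F G : MvPolynomial σ K) (n : ℕ) :
    Submodule.span K {F, G} ^ (n + 1) =
      Submodule.span K {F} * Submodule.span K {F, G} ^ n ⊔ Submodule.span K {G ^ (n + 1)} := by
  induction n with
  | zero => simp [Submodule.span_insert]
  | succ n ih =>
    have hW : Submodule.span K {F, G} = Submodule.span K {F} ⊔ Submodule.span K {G} :=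
      Submodule.span_insert _ _
    have hG : Submodule.span K {G} * Submodule.span K {F, G} ^ (n + 1) =
        Submodule.span K {F} * (Submodule.span K {G} * Submodule.span K {F, G} ^ n) ⊔
          Submodule.span K {G ^ (n + 2)} := by
      conv_lhs => rw [ih]
      rw [Submodule.mul_sup, Submodule.span_mul_span, Set.singleton_mul_singleton, ← pow_succ',
        mul_left_comm]
    have hle : Submodule.span K {F} * (Submodule.span K {G} * Submodule.span K {F, G} ^ n) ≤
        Submodule.span K {F} * Submodule.span K {F, G} ^ (n + 1) := by
      rw [pow_succ' _ n]
      gcongr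
      simp
    conv_lhs => rw [pow_succ', hW, Submodule.sup_mul, ← hW, hG, ← sup_assoc,
      sup_eq_left.mpr hle]

theorem finrank_span_singleton_mul (hF : F ≠ 0) (V : Submodule K (MvPolynomial σ K)) :
    Module.finrank K ↥(Submodule.span K {F} * V) = Module.finrank K V := by
  have h : Submodule.span K {F} * V = V.map (LinearMap.mulLeft K F) := by
    ext x
    simp [Submodule.mem_span_singleton_mul]
  rw [h]
  exact (Submodule.equivMapOfInjective _ (mul_right_injective₀ hF) V).finrank_eq.symm

theorem exists_isHomogeneous_mul_eq {d e : ℕ} {a : MvPolynomial σ K} (hF : F.IsHomogeneous e)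
    (ha : a.IsHomogeneous (d + e)) (h : F ∣ a) :
    ∃ b : MvPolynomial σ K, b.IsHomogeneous d ∧ F * b = a := by
  obtain ⟨b, rfl⟩ := h
  let := gradedAlgebra (σ := σ) (R := K)
  refine ⟨DirectSum.decompose (homogeneousSubmodule σ K) b d,
    (DirectSum.decompose (homogeneousSubmodule σ K) b d).2, ?_⟩
  have h := DirectSum.coe_decompose_mul_of_left_mem_of_le (homogeneousSubmodule σ K) (b := b)
    ((mem_homogeneousSubmodule _ _).mpr hF) (Nat.le_add_left e d)
  rw [Nat.add_sub_cancel, DirectSum.decompose_of_mem_same _ ((mem_homogeneousSubmodule _ _).mpr ha)]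
    at h
  exact h.symm

/-- The first syzygies of the powers of the ideal generated by two coprime forms `F`, `G` of the
same degree are the Koszul ones. -/
theorem span_mul_inf_eq {d e : ℕ} (hF : F.IsHomogeneous e) (hG : G.IsHomogeneous e)
    (hFG : IsRelPrime F G) (n : ℕ) :
    Submodule.span K {F} * (homogeneousSubmodule σ K (d + e) * Submodule.span K {F, G} ^ n) ⊓
        Submodule.span K {G ^ (n + 1)} * homogeneousSubmodule σ K (d + e) =
      Submodule.span K {F * G ^ (n + 1)} * homogeneousSubmodule σ K d := by
  apply le_antisymm
  · rintro x ⟨hxF, hxG⟩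
    obtain ⟨y, -, rfl⟩ := Submodule.mem_span_singleton_mul.mp hxF
    obtain ⟨a, ha, hay⟩ := Submodule.mem_span_singleton_mul.mp hxG
    have hdvd : F ∣ a := (hFG.pow_right (n := n + 1)).dvd_of_dvd_mul_left ⟨y, hay⟩
    obtain ⟨b, hb, rfl⟩ := exists_isHomogeneous_mul_eq hF ha hdvd
    exact Submodule.mem_span_singleton_mul.mpr ⟨b, hb, by rw [← hay]; ring⟩
  · intro x hx
    obtain ⟨b, hb, rfl⟩ := Submodule.mem_span_singleton_mul.mp hx
    refine ⟨Submodule.mem_span_singleton_mul.mpr ⟨b * G * G ^ n, ?_, by ring⟩,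
      Submodule.mem_span_singleton_mul.mpr ⟨b * F, IsHomogeneous.mul hb hF, by ring⟩⟩
    exact Submodule.mul_mem_mul (IsHomogeneous.mul hb hG)
      (Submodule.pow_mem_pow _ (Submodule.subset_span (by simp)) n)

theorem finrank_homogeneousSubmodule_mul_span_pow [Finite σ] {d e : ℕ} (hF : F.IsHomogeneous e)
    (hG : G.IsHomogeneous e) (hF₀ : F ≠ 0) (hG₀ : G ≠ 0) (hFG : IsRelPrime F G) (n : ℕ) :
    Module.finrank K ↥(homogeneousSubmodule σ K (d + e) * Submodule.span K {F, G} ^ n) +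
        n * Module.finrank K (homogeneousSubmodule σ K d) =
      (n + 1) * Module.finrank K (homogeneousSubmodule σ K (d + e)) := by
  induction n with
  | zero => rw [pow_zero, mul_one, zero_mul, zero_add, add_zero, one_mul]
  | succ n ih =>
    have hV : homogeneousSubmodule σ K (d + e) * Submodule.span K {F, G} ^ (n + 1) =
        Submodule.span K {F} *
            (homogeneousSubmodule σ K (d + e) * Submodule.span K {F, G} ^ n) ⊔
          Submodule.span K {G ^ (n + 1)} * homogeneousSubmodule σ K (d + e) := by
      rw [span_pair_pow_succ, Submodule.mul_sup, mul_left_comm, mul_comm _ (Submodule.span K _)]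
    have hfin (m k : ℕ) : FiniteDimensional K
        ↥(homogeneousSubmodule σ K m * Submodule.span K {F, G} ^ k) :=
      Module.Finite.iff_fg.mpr <| (homogeneousSubmodule_fg σ K m).mul <|
        (Submodule.fg_span (Set.toFinite _)).pow k
    have : FiniteDimensional K ↥(Submodule.span K {F} *
        (homogeneousSubmodule σ K (d + e) * Submodule.span K {F, G} ^ n)) :=
      Module.Finite.iff_fg.mpr <| (Submodule.fg_span (Set.toFinite _)).mul <|
        Module.Finite.iff_fg.mp (hfin _ _)
    have : FiniteDimensional K
        ↥(Submodule.span K {G ^ (n + 1)} * homogeneousSubmodule σ K (d + e)) :=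
      Module.Finite.iff_fg.mpr <| (Submodule.fg_span (Set.toFinite _)).mul <|
        homogeneousSubmodule_fg σ K _
    have h := Submodule.finrank_sup_add_finrank_inf_eq
      (Submodule.span K {F} * (homogeneousSubmodule σ K (d + e) * Submodule.span K {F, G} ^ n))
      (Submodule.span K {G ^ (n + 1)} * homogeneousSubmodule σ K (d + e))
    rw [← hV, span_mul_inf_eq hF hG hFG, finrank_span_singleton_mul hF₀,
      finrank_span_singleton_mul (pow_ne_zero _ hG₀),
      finrank_span_singleton_mul (mul_ne_zero hF₀ (pow_ne_zero _ hG₀))] at h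
    linarith

end PowSpanPair

/-- A subalgebra generated by forms of degree `m` has the powers of their span as its graded
pieces. -/
theorem adjoin_inf_homogeneousSubmodule {σ K : Type*} [Field K] {s : Set (MvPolynomial σ K)}
    {m : ℕ} (hm : m ≠ 0) (hs : ∀ p ∈ s, p.IsHomogeneous m) (n : ℕ) :
    Subalgebra.toSubmodule (Algebra.adjoin K s) ⊓ homogeneousSubmodule σ K (m * n) =
      Submodule.span K s ^ n := by
  have hP (i : ℕ) : Submodule.span K s ^ i ≤ homogeneousSubmodule σ K (m * i) := by
    induction i with
    | zero => simp [homogeneousSubmodule_zero]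
    | succ i ih =>
      rw [pow_succ]
      exact (mul_le_mul' ih (Submodule.span_le.mpr fun p hp => hs p hp)).trans
        (homogeneousSubmodule_mul _ _)
  apply le_antisymm
  · rintro x ⟨hx, hxn⟩
    rw [← homogeneousComponent_eq_self hxn]
    replace hx : x ∈ Submodule.span K (Submonoid.closure s : Set (MvPolynomial σ K)) := by
      rwa [← Algebra.adjoin_eq_span]
    clear hxn
    induction hx using Submodule.span_induction with
    | zero => simp
    | add x y _ _ hx hy => rw [map_add]; exact add_mem hx hy
    | smul c x _ hx => rw [map_smul]; exact Submodule.smul_mem _ c hx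
    | mem x hx =>
      obtain ⟨i, hi⟩ : ∃ i, x ∈ Submodule.span K s ^ i := by
        induction hx using Submonoid.closure_induction with
        | mem x hx => exact ⟨1, by simpa using Submodule.subset_span hx⟩
        | one => exact ⟨0, by simp [Submodule.one_le.mp le_rfl]⟩
        | mul x y _ _ hx hy =>
          obtain ⟨i, hi⟩ := hx
          obtain ⟨j, hj⟩ := hy
          exact ⟨i + j, pow_add (Submodule.span K s) i j ▸ Submodule.mul_mem_mul hi hj⟩
      rw [homogeneousComponent_of_mem (hP i hi)]
      split_ifs with h
      · rwa [Nat.eq_of_mul_eq_mul_left (Nat.pos_of_ne_zero hm) h]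
      · exact zero_mem _
  · refine le_inf ?_ (hP n)
    clear hs hP
    induction n with
    | zero => simp
    | succ n ih =>
      rw [pow_succ, Submodule.mul_le]
      exact fun x hx y hy => (Algebra.adjoin K s).mul_mem (ih hx) (Algebra.span_le_adjoin K s hy)

open scoped Pointwise in
theorem range_X_mul_pair {K : Type*} [Field K] (F G : MvPolynomial (Fin 3) K) :
    Set.range X * {F, G} = {X 0 * F, X 1 * F, X 2 * F, X 0 * G, X 1 * G, X 2 * G} := by
  ext p
  constructor
  · rintro ⟨_, ⟨i, rfl⟩, _, rfl | rfl, rfl⟩ <;> fin_cases i <;> simp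
  · rintro (rfl | rfl | rfl | rfl | rfl | rfl) <;>
      exact Set.mul_mem_mul (Set.mem_range_self _) (by simp)

theorem not_X_dvd_sum_cubes (K : Type*) [Field K] (i : Fin 3) :
    ¬ (X i : MvPolynomial (Fin 3) K) ∣ X 0 ^ 3 + X 1 ^ 3 + X 2 ^ 3 := by
  intro h
  have h' := map_dvd (eval (Pi.single (i + 1) (1 : K))) h
  fin_cases i <;> simp at h'

theorem isRelPrime_prod_X_sum_cubes (K : Type*) [Field K] :
    IsRelPrime (X 0 * X 1 * X 2 : MvPolynomial (Fin 3) K) (X 0 ^ 3 + X 1 ^ 3 + X 2 ^ 3) := by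
  have h (i : Fin 3) : IsRelPrime (X i : MvPolynomial (Fin 3) K) (X 0 ^ 3 + X 1 ^ 3 + X 2 ^ 3) :=
    (X_prime.irreducible.isRelPrime_iff_not_dvd).mpr (not_X_dvd_sum_cubes K i)
  exact ((h 0).mul_left (h 1)).mul_left (h 2)

end MvPolynomial

/-- Let `K` be a field of characteristic zero, `F = X₁X₂X₃`,
`G = X₁³ + X₂³ + X₃³`, and `R` the `K`-subalgebra of `K[X₁,X₂,X₃]` generated by
`X₁F, X₂F, X₃F, X₁G, X₂G, X₃G`.  Then there is a positive integer `N` such that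
for all `n ≥ N`, the `K`-vector space of elements of `R` which are homogeneous
polynomials of degree `4n` has dimension `3n(n+1) + (n−1)(n−2)/2`. -/
theorem stmt_14 (K : Type*) [Field K] [CharZero K]
    (F G : MvPolynomial (Fin 3) K)
    (hF : F = X 0 * X 1 * X 2)
    (hG : G = X 0 ^ 3 + X 1 ^ 3 + X 2 ^ 3)
    (R : Subalgebra K (MvPolynomial (Fin 3) K))
    (hR : R = Algebra.adjoin K
      {X 0 * F, X 1 * F, X 2 * F, X 0 * G, X 1 * G, X 2 * G}) :
    ∃ N : ℕ, 0 < N ∧ ∀ n ≥ N,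
      Module.finrank K
        ↥(Subalgebra.toSubmodule R ⊓ homogeneousSubmodule (Fin 3) K (4 * n)) =
      3 * n * (n + 1) + (n - 1) * (n - 2) / 2 := by
  subst hF hG hR
  set F : MvPolynomial (Fin 3) K := X 0 * X 1 * X 2 with hF
  set G : MvPolynomial (Fin 3) K := X 0 ^ 3 + X 1 ^ 3 + X 2 ^ 3 with hG
  have hFh : F.IsHomogeneous 3 :=
    ((isHomogeneous_X K 0).mul (isHomogeneous_X K 1)).mul (isHomogeneous_X K 2)
  have hGh : G.IsHomogeneous 3 :=
    ((isHomogeneous_X_pow (R := K) 0 3).add (isHomogeneous_X_pow (R := K) 1 3)).add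
      (isHomogeneous_X_pow (R := K) 2 3)
  have hF₀ : F ≠ 0 := by simp [hF]
  have hG₀ : G ≠ 0 := fun h => not_X_dvd_sum_cubes K 0 (by rw [← hG, h]; exact dvd_zero _)
  refine ⟨3, by norm_num, fun n hn => ?_⟩
  rw [← range_X_mul_pair, adjoin_inf_homogeneousSubmodule (by norm_num),
    ← Submodule.span_mul_span, mul_pow, ← homogeneousSubmodule_one_eq_span_X,
    homogeneousSubmodule_one_pow]
  · obtain ⟨d, rfl⟩ := Nat.exists_eq_add_of_le' hn
    have h := finrank_homogeneousSubmodule_mul_span_pow (d := d) hFh hGh hF₀ hG₀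
      (isRelPrime_prod_X_sum_cubes K) (d + 3)
    have hchoose (k : ℕ) : 2 * (Fintype.card (Fin 3) + k - 1).choose k = (k + 2) * (k + 1) := by
      rw [Fintype.card_fin, show 3 + k - 1 = k + 2 by omega, Nat.choose_symm_add,
        Nat.choose_two_right]
      exact Nat.mul_div_cancel' (Nat.even_mul_pred_self _).two_dvd
    have h₁ := hchoose d
    have h₂ := hchoose (d + 3)
    rw [← finrank_homogeneousSubmodule (Fin 3) K] at h₁ h₂
    have h₃ : 2 * ((d + 3 - 1) * (d + 3 - 2) / 2) = (d + 2) * (d + 1) :=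
      Nat.mul_div_cancel' (Nat.even_mul_pred_self (d + 2)).two_dvd
    nlinarith
  · rintro _ ⟨_, ⟨i, rfl⟩, _, rfl | rfl, rfl⟩
    · exact (isHomogeneous_X K i).mul hFh
    · exact (isHomogeneous_X K i).mul hGh
end

section
/- Let K be a field of characteristic p ≥ 7 and let R = K[X, Y, Z]/(X² + Y³ + Z⁵). Then every ideal of R is tightly closed; that is, for every ideal I of R and every x ∈ R, if there exist a nonzero element c ∈ R and e₀ ≥ 0 such that c·x^{p^e} ∈ I^{[p^e]} for all e ≥ e₀, then x ∈ I. In other words, R is weakly F-regular. -/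
open MvPolynomial

/-- The Frobenius power `I^{[q]}` of an ideal `I`: the ideal generated by the
`q`-th powers of the elements of `I`. -/
def frobeniusPower {R : Type*} [CommRing R] (I : Ideal R) (q : ℕ) : Ideal R :=
  Ideal.span ((fun r => r ^ q) '' (I : Set R))

/-- An additive map `φ` is `q`-Cartier if it is `q⁻¹`-linear: `φ (r ^ q * s) = r * φ s`. -/
def IsCartier {R : Type*} [CommRing R] (q : ℕ) (φ : R →+ R) : Prop :=
  ∀ r s, φ (r ^ q * s) = r * φ s

namespace IsCartier

variable {R : Type*} [CommRing R]

theorem map_mem_of_mem_frobeniusPower {q : ℕ} {φ : R →+ R} (hφ : IsCartier q φ) {J : Ideal R}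
    {y : R} (hy : y ∈ frobeniusPower J q) : φ y ∈ J := by
  suffices h : ∀ d, φ (d * y) ∈ J by simpa using h 1
  unfold frobeniusPower at hy
  induction hy using Submodule.span_induction with
  | mem x hx =>
    obtain ⟨j, hj, rfl⟩ := hx
    intro d
    rw [mul_comm]
    exact (hφ j d).symm ▸ J.mul_mem_right _ hj
  | zero => simp
  | add x y _ _ hx hy =>
    intro d
    rw [mul_add, map_add]
    exact J.add_mem (hx d) (hy d)
  | smul a x _ hx =>
    intro d
    rw [smul_eq_mul, ← mul_assoc]
    exact hx _

theorem mem_of_mul_pow_mem {q : ℕ} {φ : R →+ R} (hφ : IsCartier q φ) {J : Ideal R} {c d x : R}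
    (hcd : φ (c * d) = 1) (h : c * x ^ q ∈ frobeniusPower J q) : x ∈ J := by
  have h1 := hφ.map_mem_of_mem_frobeniusPower (Ideal.mul_mem_right d _ h)
  rwa [show c * x ^ q * d = x ^ q * (c * d) by ring, hφ, hcd, mul_one] at h1

theorem comp {q q' : ℕ} {φ φ' : R →+ R} (hφ : IsCartier q φ) (hφ' : IsCartier q' φ') :
    IsCartier (q * q') (φ'.comp φ) := by
  intro r s
  simp only [AddMonoidHom.comp_apply]
  rw [mul_comm q, pow_mul, hφ, hφ']

theorem conj {S : Type*} [CommRing S] (e : R ≃+* S) {q : ℕ} {φ : S →+ S} (hφ : IsCartier q φ) :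
    IsCartier q ((e.symm.toAddEquiv.toAddMonoidHom.comp φ).comp e.toAddEquiv.toAddMonoidHom) := by
  intro r s
  have := hφ (e r) (e s)
  simp [this]

end IsCartier

/-- A field extension has a linear functional taking the value `1` at a given nonzero element. -/
theorem exists_addMonoidHom_semilinear_eq_one {k L : Type*} [Field k] [Field L] (σ : k →+* L)
    {b : L} (hb : b ≠ 0) :
    ∃ f : L →+ k, (∀ a x, f (σ a * x) = a * f x) ∧ f b = 1 := by
  let _ := σ.toAlgebra
  obtain ⟨f, hf⟩ : ∃ f : Module.Dual k L, f b ≠ 0 := by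
    by_contra! h
    exact hb ((Module.forall_dual_apply_eq_zero_iff k b).1 h)
  refine ⟨((f b)⁻¹ • f).toAddMonoidHom, fun a x => ?_, ?_⟩
  · have : σ a * x = a • x := (Algebra.smul_def a x).symm
    simp only [this, LinearMap.toAddMonoidHom_coe, map_smul, smul_eq_mul]
  · simp [hf]

namespace MvPolynomial

section Cartier

variable {σ K : Type*} [Field K]

theorem injective_nsmul_add {q : ℕ} (hq : q ≠ 0) (n : σ →₀ ℕ) :
    Function.Injective fun m : σ →₀ ℕ => q • m + n := by
  intro m m' h
  ext i
  have := DFunLike.congr_fun h i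
  simpa [hq] using this

/-- The additive map sending `g` to the polynomial whose coefficient at `m` is
`f (coeff (q • m + n) g)`. -/
noncomputable def residueMap {q : ℕ} (hq : q ≠ 0) (n : σ →₀ ℕ) (f : K →+ K) :
    MvPolynomial σ K →+ MvPolynomial σ K where
  toFun g := ∑ m ∈ g.support.preimage _ (injective_nsmul_add hq n).injOn,
    monomial m (f (coeff (q • m + n) g))
  map_zero' := by simp
  map_add' g h := by
    classical
    have key : ∀ c : K, (if c ≠ 0 then f c else 0) = f c := fun c => by
      split_ifs with hc
      · rfl
      · rw [not_not.1 hc, map_zero]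
    ext m
    rw [coeff_add]
    simp only [coeff_sum, coeff_monomial, Finset.sum_ite_eq', Finset.mem_preimage,
      mem_support_iff, key]
    rw [coeff_add, map_add]

theorem coeff_residueMap {q : ℕ} (hq : q ≠ 0) (n : σ →₀ ℕ) (f : K →+ K) (g : MvPolynomial σ K)
    (m : σ →₀ ℕ) : coeff m (residueMap hq n f g) = f (coeff (q • m + n) g) := by
  classical
  simp only [residueMap, AddMonoidHom.coe_mk, ZeroHom.coe_mk, coeff_sum, coeff_monomial,
    Finset.sum_ite_eq', Finset.mem_preimage, mem_support_iff]
  split_ifs with h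
  · rfl
  · rw [not_not] at h
    rw [h, map_zero]

theorem isCartier_residueMap (p : ℕ) [Fact p.Prime] [CharP K p] (e : ℕ) (hq : p ^ e ≠ 0)
    {n : σ →₀ ℕ} (hn : ∀ i, n i < p ^ e) {f : K →+ K}
    (hf : ∀ a x, f (a ^ p ^ e * x) = a * f x) : IsCartier (p ^ e) (residueMap hq n f) := by
  intro r s
  induction r using MvPolynomial.induction_on' with
  | monomial t c =>
    ext m
    rw [coeff_residueMap, monomial_pow, coeff_monomial_mul', coeff_monomial_mul']
    have hle : p ^ e • t ≤ p ^ e • m + n ↔ t ≤ m := by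
      constructor
      · intro h i
        have h1 := h i
        have h2 := hn i
        simp only [Finsupp.coe_smul, Finsupp.coe_add, Pi.add_apply, Pi.smul_apply,
          smul_eq_mul] at h1
        by_contra! h3
        have h4 : p ^ e * (m i + 1) ≤ p ^ e * t i := Nat.mul_le_mul_left _ h3
        rw [mul_add] at h4
        omega
      · intro h
        exact (nsmul_le_nsmul_right h _).trans le_self_add
    by_cases h : t ≤ m
    · rw [if_pos (hle.2 h), if_pos h, hf, coeff_residueMap]
      congr 3
      ext i
      have h1 := Nat.mul_le_mul_left (p ^ e) (h i)
      simp only [Finsupp.coe_smul, Finsupp.coe_add, Pi.add_apply, Pi.smul_apply,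
        smul_eq_mul, Finsupp.coe_tsub, Pi.sub_apply, Nat.mul_sub]
      omega
    · rw [if_neg (mt hle.1 h), if_neg h, map_zero]
  | add a b ha hb => rw [add_pow_char_pow, add_mul, map_add, ha, hb, add_mul]

theorem exists_isCartier_eq_one (p : ℕ) [Fact p.Prime] [CharP K p] (e : ℕ)
    {g : MvPolynomial σ K} {n : σ →₀ ℕ} (hn : ∀ i, n i < p ^ e) (hg : coeff n g ≠ 0)
    (h : ∀ m ≠ 0, coeff (p ^ e • m + n) g = 0) :
    ∃ ψ : MvPolynomial σ K →+ MvPolynomial σ K, IsCartier (p ^ e) ψ ∧ ψ g = 1 := by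
  classical
  obtain ⟨f, hf, hf1⟩ := exists_addMonoidHom_semilinear_eq_one (iterateFrobenius K p e) hg
  have hq : p ^ e ≠ 0 := pow_ne_zero _ (Fact.out : p.Prime).ne_zero
  refine ⟨residueMap hq n f, isCartier_residueMap p e hq hn ?_, ?_⟩
  · simpa [iterateFrobenius_def] using hf
  · ext m
    rw [coeff_residueMap, coeff_one]
    split_ifs with hm
    · subst hm
      simpa using hf1
    · rw [h m (Ne.symm hm), map_zero]

theorem exists_isCartier_eq_one_of_ne_zero (p : ℕ) [Fact p.Prime] [CharP K p]
    {g : MvPolynomial σ K} (hg : g ≠ 0) (e₀ : ℕ) :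
    ∃ e ≥ e₀, ∃ ψ : MvPolynomial σ K →+ MvPolynomial σ K, IsCartier (p ^ e) ψ ∧ ψ g = 1 := by
  obtain ⟨n, hn⟩ := ne_zero_iff.1 hg
  have hp : 1 < p := (Fact.out : p.Prime).one_lt
  have hlt : g.totalDegree < p ^ (e₀ + g.totalDegree) :=
    (Nat.lt_pow_self hp).trans_le (Nat.pow_le_pow_right hp.le (Nat.le_add_left _ _))
  have hdeg : ∀ m, coeff m g ≠ 0 → ∀ i, m i < p ^ (e₀ + g.totalDegree) := fun m hm i =>
    ((Finsupp.le_degree i m).trans (le_totalDegree (mem_support_iff.2 hm))).trans_lt hlt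
  refine ⟨_, Nat.le_add_right _ _, exists_isCartier_eq_one p _ (hdeg n hn) hn fun m hm => ?_⟩
  by_contra h
  obtain ⟨i, hi⟩ := Finsupp.ne_iff.1 hm
  have h1 := hdeg _ h i
  have h2 : 1 ≤ m i := Nat.one_le_iff_ne_zero.2 hi
  have h3 := Nat.mul_le_mul_left (p ^ (e₀ + g.totalDegree)) h2
  simp only [Finsupp.coe_smul, Finsupp.coe_add, Pi.add_apply, Pi.smul_apply, smul_eq_mul] at h1
  omega

end Cartier

section Discriminant

variable (K : Type*) [Field K]

/-- The polynomial `-(Y³ + Z⁵)`, with `Y` and `Z` the variables `0` and `1`. -/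
noncomputable def negCubeAddQuintic : MvPolynomial (Fin 2) K := -(X 0 ^ 3 + X 1 ^ 5)

/-- The double cover `X² = -(Y³ + Z⁵)` of the plane. -/
abbrev DoubleCover : Type _ :=
  QuadraticAlgebra (MvPolynomial (Fin 2) K) (negCubeAddQuintic K) 0

theorem coeff_negCubeAddQuintic_pow (n : ℕ) (m : Fin 2 →₀ ℕ) :
    coeff m (negCubeAddQuintic K ^ n) = ∑ j ∈ Finset.range (n + 1),
      if Finsupp.single 0 (3 * j) + Finsupp.single 1 (5 * (n - j)) = m
      then (-1) ^ n * (n.choose j : K) else 0 := by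
  rw [negCubeAddQuintic, neg_pow, add_pow, Finset.mul_sum, coeff_sum]
  refine Finset.sum_congr rfl fun j _ => ?_
  have : (-1 : MvPolynomial (Fin 2) K) ^ n * ((X 0 ^ 3) ^ j * (X 1 ^ 5) ^ (n - j) *
      (n.choose j : MvPolynomial (Fin 2) K)) =
      monomial (Finsupp.single 0 (3 * j) + Finsupp.single 1 (5 * (n - j)))
        ((-1) ^ n * (n.choose j : K)) := by
    rw [← mul_one (_ * _ : K), ← C_mul_monomial, ← mul_one (1 : K), ← monomial_mul,
      ← X_pow_eq_monomial, ← X_pow_eq_monomial, pow_mul, pow_mul]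
    simp only [map_mul, map_pow, map_neg, map_one, map_natCast]
    ring
  rw [this, coeff_monomial]

theorem totalDegree_negCubeAddQuintic : (negCubeAddQuintic K).totalDegree = 5 := by
  rw [negCubeAddQuintic, totalDegree_neg, totalDegree_add_eq_right_of_totalDegree_lt] <;>
    simp [totalDegree_X_pow]

theorem sq_ne_negCubeAddQuintic_mul_sq {u v : MvPolynomial (Fin 2) K} (hv : v ≠ 0) :
    u * u ≠ negCubeAddQuintic K * v * v := by
  intro h
  have ha : negCubeAddQuintic K ≠ 0 := by
    intro h0
    have := totalDegree_negCubeAddQuintic K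
    simp [h0] at this
  have hu : u ≠ 0 := by
    rintro rfl
    simp [ha, hv] at h
  have := congrArg totalDegree h
  rw [totalDegree_mul_of_isDomain hu hu, totalDegree_mul_of_isDomain (mul_ne_zero ha hv) hv,
    totalDegree_mul_of_isDomain ha hv, totalDegree_negCubeAddQuintic] at this
  omega

end Discriminant

end MvPolynomial

theorem Nat.Prime.not_dvd_choose_of_lt {p n k : ℕ} (hp : p.Prime) (hn : n < p) (hk : k ≤ n) :
    ¬ p ∣ n.choose k := fun h =>
  absurd ((hp.dvd_factorial).1 (h.trans ⟨_, by
    rw [← mul_assoc, Nat.choose_mul_factorial_mul_factorial hk]⟩)) (not_le.2 hn)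

/-- A binomial coefficient whose entries are added without carry in base `p` is prime to `p`. -/
theorem Nat.Prime.not_dvd_choose_of_digits_le {p a b c d : ℕ} (hp : p.Prime) (ha : a < p)
    (hb : b < p) (hc : c ≤ a) (hd : d ≤ b) : ¬ p ∣ (a + p * b).choose (c + p * d) := by
  have := Fact.mk hp
  have h := Choose.choose_modEq_choose_mod_mul_choose_div_nat
    (n := a + p * b) (k := c + p * d) (p := p)
  rw [Nat.add_mul_mod_self_left, Nat.add_mul_mod_self_left, Nat.add_mul_div_left _ _ hp.pos,
    Nat.add_mul_div_left _ _ hp.pos, Nat.mod_eq_of_lt ha, Nat.mod_eq_of_lt (hc.trans_lt ha),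
    Nat.div_eq_of_lt ha, Nat.div_eq_of_lt (hc.trans_lt ha), zero_add, zero_add] at h
  rw [h.dvd_iff dvd_rfl, hp.dvd_mul]
  exact not_or.2 ⟨hp.not_dvd_choose_of_lt ha hc, hp.not_dvd_choose_of_lt hb hd⟩

theorem exists_choose_not_dvd_of_seven_le {p : ℕ} (hp : p.Prime) (h7 : 7 ≤ p) :
    ∃ n j : ℕ, 2 * n = p ^ 2 + 1 ∧ j ≤ n ∧ 3 * j < p ^ 2 ∧ 5 * (n - j) < p ^ 2 ∧
      ¬ p ∣ n.choose j := by
  have h2 : ¬ 2 ∣ p := fun h => by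
    have := (Nat.prime_dvd_prime_iff_eq Nat.prime_two hp).1 h
    omega
  have h3 : ¬ 3 ∣ p := fun h => by
    have := (Nat.prime_dvd_prime_iff_eq Nat.prime_three hp).1 h
    omega
  have h6 : p = 6 * (p / 6) + 1 ∨ p = 6 * (p / 6) + 5 := by omega
  obtain ⟨m, hm⟩ : ∃ m, m = p / 6 := ⟨_, rfl⟩
  rw [← hm] at h6
  have hm1 : 1 ≤ m := by omega
  rcases h6 with h | h
  · refine ⟨(3 * m + 1) + p * (3 * m), 2 * m + p * (2 * m), ?_, ?_, ?_, ?_,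
      hp.not_dvd_choose_of_digits_le ?_ ?_ ?_ ?_⟩
    · subst h; ring
    · gcongr <;> omega
    · subst h; nlinarith
    · have : (3 * m + 1) + p * (3 * m) - (2 * m + p * (2 * m)) = (m + 1) + p * m := by
        rw [Nat.sub_eq_iff_eq_add (by gcongr <;> omega)]; ring
      rw [this]
      subst h; nlinarith
    all_goals omega
  · refine ⟨(3 * m + 3) + p * (3 * m + 2), (3 * m + 3) + p * (2 * m + 1), ?_, ?_, ?_, ?_,
      hp.not_dvd_choose_of_digits_le ?_ ?_ ?_ ?_⟩
    · subst h; ring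
    · gcongr <;> omega
    · subst h; nlinarith
    · have : (3 * m + 3) + p * (3 * m + 2) - ((3 * m + 3) + p * (2 * m + 1)) = p * (m + 1) := by
        rw [Nat.sub_eq_iff_eq_add (by gcongr <;> omega)]; ring
      rw [this]
      subst h; nlinarith
    all_goals omega

namespace MvPolynomial

variable {K : Type*} [Field K] {p : ℕ} [Fact p.Prime] [CharP K p]

theorem exists_isCartier_negCubeAddQuintic_pow (h7 : 7 ≤ p) :
    ∃ n, 2 * n = p ^ 2 + 1 ∧ ∃ ψ : MvPolynomial (Fin 2) K →+ MvPolynomial (Fin 2) K,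
      IsCartier (p ^ 2) ψ ∧ ψ (negCubeAddQuintic K ^ n) = 1 := by
  have hp : p.Prime := Fact.out
  obtain ⟨n, j, hn, hj, hj3, hj5, hdvd⟩ := exists_choose_not_dvd_of_seven_le hp h7
  refine ⟨n, hn, exists_isCartier_eq_one p 2
    (n := Finsupp.single 0 (3 * j) + Finsupp.single 1 (5 * (n - j))) ?_ ?_ fun m hm => ?_⟩
  · intro i
    fin_cases i <;> simpa
  · rw [coeff_negCubeAddQuintic_pow, Finset.sum_eq_single_of_mem j (by simpa [Nat.lt_succ_iff])]
    · rw [if_pos rfl]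
      exact mul_ne_zero (pow_ne_zero _ (neg_ne_zero.2 one_ne_zero))
        (mt (CharP.cast_eq_zero_iff K p _).1 hdvd)
    · intro i _ hi
      refine if_neg fun h => hi ?_
      have := DFunLike.congr_fun h 0
      simpa using this
  · rw [coeff_negCubeAddQuintic_pow]
    refine Finset.sum_eq_zero fun i hi => if_neg fun h => hm ?_
    have hi' : i ≤ n := by simpa [Nat.lt_succ_iff] using hi
    have h0 : 3 * i = p ^ 2 * m 0 + 3 * j := by simpa using DFunLike.congr_fun h 0
    have h1 : 5 * (n - i) = p ^ 2 * m 1 + 5 * (n - j) := by simpa using DFunLike.congr_fun h 1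
    have hij : i = j := by
      have : j ≤ i := by
        have := Nat.zero_le (p ^ 2 * m 0)
        omega
      have : n - j ≤ n - i := by
        have := Nat.zero_le (p ^ 2 * m 1)
        omega
      omega
    subst hij
    ext k
    fin_cases k
    · simpa [hp.ne_zero] using h0
    · simpa [hp.ne_zero] using h1

theorem exists_isCartier_negCubeAddQuintic_pow_mul (h7 : 7 ≤ p) {d : MvPolynomial (Fin 2) K}
    (hd : d ≠ 0) (e₀ : ℕ) :
    ∃ e ≥ e₀, ∃ k, 2 * k + 1 = p ^ e ∧
      ∃ ψ : MvPolynomial (Fin 2) K →+ MvPolynomial (Fin 2) K,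
        IsCartier (p ^ e) ψ ∧ ∃ h, ψ (negCubeAddQuintic K ^ k * (d * h)) = 1 := by
  have hp : p.Prime := Fact.out
  obtain ⟨n, hn, ψ, hψ, hψ1⟩ := exists_isCartier_negCubeAddQuintic_pow (K := K) h7
  obtain ⟨e, he, χ, hχ, hχ1⟩ := exists_isCartier_eq_one_of_ne_zero p hd e₀
  have hodd : ∀ i, Odd (p ^ i) := fun i => (hp.odd_of_ne_two (by omega)).pow
  obtain ⟨k, hk⟩ := hodd (e + 2)
  obtain ⟨l, hl⟩ := hodd e
  refine ⟨e + 2, by omega, k, hk.symm, ψ.comp χ, pow_add p e 2 ▸ hχ.comp hψ,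
    negCubeAddQuintic K ^ (l + 1), ?_⟩
  have hkl : k + (l + 1) = n * p ^ e := by
    have : 2 * (n * p ^ e) = (p ^ 2 + 1) * p ^ e := by rw [← hn]; ring
    have h3 : p ^ (e + 2) = p ^ 2 * p ^ e := by ring
    rw [add_mul, one_mul, ← h3] at this
    omega
  rw [show negCubeAddQuintic K ^ k * (d * negCubeAddQuintic K ^ (l + 1)) =
      (negCubeAddQuintic K ^ n) ^ p ^ e * d by rw [← pow_mul, ← hkl]; ring,
    AddMonoidHom.comp_apply, hχ, hχ1, mul_one, hψ1]

end MvPolynomial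

namespace QuadraticAlgebra

variable {A : Type*} [CommRing A] {a : A}

/-- The extension of a Cartier map `ψ` of `A` to `A[ω]`, `ω² = a`:
it sends `u + v ω` to `ψ (a ^ k * u) + ψ v ω`. -/
def extendCartier (a : A) (k : ℕ) (ψ : A →+ A) :
    QuadraticAlgebra A a 0 →+ QuadraticAlgebra A a 0 where
  toFun z := ⟨ψ (a ^ k * z.re), ψ z.im⟩
  map_zero' := by ext <;> simp
  map_add' z w := by ext <;> simp [mul_add]

theorem omega_pow_odd (k : ℕ) :
    (ω : QuadraticAlgebra A a 0) ^ (2 * k + 1) = ⟨0, a ^ k⟩ := by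
  induction k with
  | zero => ext <;> simp
  | succ k ih =>
    rw [show 2 * (k + 1) + 1 = (2 * k + 1) + 2 by ring, pow_add, ih, sq]
    ext <;> simp [pow_succ]

theorem isCartier_extendCartier (p : ℕ) [Fact p.Prime] [CharP A p] {e k : ℕ}
    (hk : 2 * k + 1 = p ^ e) {ψ : A →+ A} (hψ : IsCartier (p ^ e) ψ) :
    IsCartier (p ^ e) (extendCartier a k ψ) := by
  have : CharP (QuadraticAlgebra A a 0) p :=
    charP_of_injective_ringHom (f := algebraMap A (QuadraticAlgebra A a 0))
      algebraMap_injective p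
  rintro ⟨s, t⟩ ⟨u, v⟩
  have hpow : (⟨s, t⟩ : QuadraticAlgebra A a 0) ^ p ^ e = ⟨s ^ p ^ e, t ^ p ^ e * a ^ k⟩ := by
    have hs : algebraMap A (QuadraticAlgebra A a 0) s ^ p ^ e = ⟨s ^ p ^ e, 0⟩ :=
      (map_pow (algebraMap A (QuadraticAlgebra A a 0)) s _).symm
    rw [mk_eq_add_smul_omega, add_pow_char_pow, hs, smul_pow, ← hk, omega_pow_odd]
    ext <;> simp
  rw [hpow]
  have h1 : a ^ k * (s ^ p ^ e * u + a * (t ^ p ^ e * a ^ k) * v) =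
      s ^ p ^ e * (a ^ k * u) + (t * a) ^ p ^ e * v := by
    rw [mul_pow, ← hk]; ring
  have h2 : s ^ p ^ e * v + t ^ p ^ e * a ^ k * u =
      s ^ p ^ e * v + t ^ p ^ e * (a ^ k * u) := by ring
  ext
  · simp only [extendCartier, AddMonoidHom.coe_mk, ZeroHom.coe_mk, re_mul]
    rw [h1, map_add, hψ, hψ]
    ring
  · simp only [extendCartier, AddMonoidHom.coe_mk, ZeroHom.coe_mk, im_mul, zero_mul, add_zero]
    rw [h2, map_add, hψ, hψ]

end QuadraticAlgebra

open MvPolynomial in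
theorem QuadraticAlgebra.exists_isCartier_mul_eq_one {K : Type*} [Field K] {p : ℕ} [Fact p.Prime]
    [CharP K p] (h7 : 7 ≤ p) {c : DoubleCover K}
    (hc : c ≠ 0) (e₀ : ℕ) :
    ∃ e ≥ e₀, ∃ φ, IsCartier (p ^ e) φ ∧ ∃ d, φ (c * d) = 1 := by
  obtain ⟨u, v⟩ := c
  have hd : u * u - negCubeAddQuintic K * v * v ≠ 0 := by
    intro h
    rcases eq_or_ne v 0 with rfl | hv
    · have : u = 0 := by simpa using h
      exact hc (by rw [this]; rfl)
    · exact sq_ne_negCubeAddQuintic_mul_sq K hv (sub_eq_zero.1 h)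
  obtain ⟨e, he, k, hk, ψ, hψ, h, hψ1⟩ :=
    exists_isCartier_negCubeAddQuintic_pow_mul (p := p) h7 hd e₀
  refine ⟨e, he, _, isCartier_extendCartier p hk hψ, ⟨u * h, -v * h⟩, ?_⟩
  rw [mk_mul_mk]
  ext1
  · simp only [extendCartier, AddMonoidHom.coe_mk, ZeroHom.coe_mk, re_one]
    rw [← hψ1]
    congr 2
    ring
  · simp only [extendCartier, AddMonoidHom.coe_mk, ZeroHom.coe_mk, im_one]
    exact (congrArg ψ (by ring)).trans (map_zero ψ)

/-- The ring homomorphism from `A[ω]`, `ω² = a`, determined by a homomorphism `g` from `A` and a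
square root of `g a`. -/
def QuadraticAlgebra.liftRingHom {A B : Type*} [CommRing A] [CommRing B] {a : A} (g : A →+* B)
    (x : B) (hx : x * x = g a) : QuadraticAlgebra A a 0 →+* B where
  toFun z := g z.re + g z.im * x
  map_one' := by simp
  map_zero' := by simp
  map_add' z w := by
    simp only [re_add, im_add, map_add]
    ring
  map_mul' z w := by
    simp only [re_mul, im_mul, map_add, map_mul, zero_mul, add_zero]
    linear_combination (-g z.im * g w.im) * hx

namespace MvPolynomial

variable (K : Type*) [Field K]

/-- The surface `X² + Y³ + Z⁵ = 0` as the double cover `X² = -(Y³ + Z⁵)` of the plane. -/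
theorem nonempty_ringEquiv_quadraticAlgebra :
    Nonempty ((MvPolynomial (Fin 3) K ⧸
      (Ideal.span {X 0 ^ 2 + X 1 ^ 3 + X 2 ^ 5} : Ideal (MvPolynomial (Fin 3) K))) ≃+*
      DoubleCover K) := by
  set I : Ideal (MvPolynomial (Fin 3) K) := Ideal.span {X 0 ^ 2 + X 1 ^ 3 + X 2 ^ 5} with hI
  let i : MvPolynomial (Fin 2) K →ₐ[K] DoubleCover K := IsScalarTower.toAlgHom K _ (DoubleCover K)
  have hi : ∀ f, i f = algebraMap (MvPolynomial (Fin 2) K) (DoubleCover K) f := fun _ => rfl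
  let w : DoubleCover K := QuadraticAlgebra.omega
  have hw : w * w = i (negCubeAddQuintic K) := by
    apply QuadraticAlgebra.ext <;> simp [w, hi]
  have hia : i (negCubeAddQuintic K) = -(i (X 0) ^ 3 + i (X 1) ^ 5) := by
    rw [← map_pow, ← map_pow, ← map_add, ← map_neg]
    rfl
  let F : MvPolynomial (Fin 3) K →ₐ[K] DoubleCover K := aeval ![w, i (X 0), i (X 1)]
  have hF : ∀ f ∈ I, F f = 0 := by
    intro f hf
    suffices I ≤ RingHom.ker F from this hf
    rw [hI, Ideal.span_le, Set.singleton_subset_iff]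
    simp only [SetLike.mem_coe, RingHom.mem_ker, F, map_add, map_pow, aeval_X]
    simp only [Matrix.cons_val]
    linear_combination hw + hia
  let Fbar : (MvPolynomial (Fin 3) K ⧸ I) →ₐ[K] DoubleCover K := Ideal.Quotient.liftₐ I F hF
  let x : Fin 3 → MvPolynomial (Fin 3) K ⧸ I := fun j => Ideal.Quotient.mk I (X j)
  have hx : x 0 ^ 2 + x 1 ^ 3 + x 2 ^ 5 = 0 := by
    simp only [x, ← map_pow, ← map_add]
    exact Ideal.Quotient.eq_zero_iff_mem.2 (Ideal.subset_span rfl)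
  have hFx : ∀ j, Fbar (x j) = ![w, i (X 0), i (X 1)] j := fun j =>
    (Ideal.Quotient.lift_mk I _ _).trans (aeval_X _ j)
  let g : MvPolynomial (Fin 2) K →ₐ[K] (MvPolynomial (Fin 3) K ⧸ I) := aeval ![x 1, x 2]
  have hg : Fbar.comp g = i := by
    apply MvPolynomial.algHom_ext
    intro j
    simp only [AlgHom.comp_apply, g, aeval_X]
    fin_cases j
    · exact hFx 1
    · exact hFx 2
  let G : DoubleCover K →+* (MvPolynomial (Fin 3) K ⧸ I) :=
    QuadraticAlgebra.liftRingHom g.toRingHom (x 0) (by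
      simp only [g, negCubeAddQuintic, AlgHom.toRingHom_eq_coe, RingHom.coe_coe, map_neg, map_add,
        map_pow, aeval_X]
      simp only [Matrix.cons_val]
      linear_combination hx)
  have hG : ∀ q : DoubleCover K, G q = g q.re + g q.im * x 0 := fun _ => rfl
  have hGi : ∀ f, G (i f) = g f := fun f => by simp [hG, hi]
  have hFG : ∀ q, Fbar (G q) = q := by
    intro q
    have h : ∀ f, Fbar (g f) = i f := DFunLike.congr_fun hg
    rw [hG, map_add, map_mul, h, h, hFx]
    apply QuadraticAlgebra.ext <;> simp [hi, w]
  have hGF : G.comp Fbar.toRingHom = RingHom.id _ := by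
    apply Ideal.Quotient.ringHom_ext
    apply MvPolynomial.ringHom_ext
    · intro r
      change G (Fbar (algebraMap K _ r)) = algebraMap K _ r
      rw [AlgHom.commutes, ← i.commutes, hGi, g.commutes]
    · intro j
      change G (Fbar (x j)) = x j
      rw [hFx]
      fin_cases j
      · simp [hG, w]
      · exact (hGi _).trans (aeval_X _ _)
      · exact (hGi _).trans (aeval_X _ _)
  exact ⟨RingEquiv.ofBijective Fbar.toRingHom
    ⟨Function.LeftInverse.injective (g := G) (DFunLike.congr_fun hGF),
      Function.RightInverse.surjective (g := G) hFG⟩⟩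

end MvPolynomial

/-- Let `K` be a field of characteristic `p ≥ 7` and
`R = K[X,Y,Z]/(X² + Y³ + Z⁵)`.  Then every ideal of `R` is tightly closed:
if there are a nonzero `c` and `e₀` with `c·x^{p^e} ∈ J^{[p^e]}` for all
`e ≥ e₀`, then `x ∈ J`.  That is, `R` is weakly F-regular. -/
theorem stmt_16 (K : Type*) [Field K] (p : ℕ) [Fact p.Prime] [CharP K p]
    (hp : 7 ≤ p)
    (I : Ideal (MvPolynomial (Fin 3) K))
    (hI : I = Ideal.span {X 0 ^ 2 + X 1 ^ 3 + X 2 ^ 5}) :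
    ∀ (J : Ideal (MvPolynomial (Fin 3) K ⧸ I)) (x : MvPolynomial (Fin 3) K ⧸ I),
      (∃ c : MvPolynomial (Fin 3) K ⧸ I, c ≠ 0 ∧ ∃ e₀ : ℕ, ∀ e ≥ e₀,
        c * x ^ p ^ e ∈ frobeniusPower J (p ^ e)) →
      x ∈ J := by
  subst hI
  rintro J x ⟨c, hc, e₀, h⟩
  obtain ⟨E⟩ := nonempty_ringEquiv_quadraticAlgebra K
  obtain ⟨e, he, φ, hφ, d, hd⟩ :=
    QuadraticAlgebra.exists_isCartier_mul_eq_one hp (E.map_ne_zero_iff.2 hc) e₀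
  refine (hφ.conj E).mem_of_mul_pow_mem (d := E.symm d) ?_ (h e he)
  simp [hd]
end

section
/- Let K be a field, let S = K[X, Y, Z]/(X³ − YZ(Y+Z)) with x, y, z the images of X, Y, Z, and let R be the K-subalgebra of S generated by x, y³, y²z, yz², z³. Then for every nonnegative integer m and every homogeneous polynomial P ∈ K[X, Y, Z] of degree 3m (with respect to the standard grading), if the image of P in S lies in R, then that image lies in the K-subalgebra of S generated by y³, y²z, yz², z³. In other words, the third Veronese subring R^{(3)} of R equals K[y³, y²z, yz², z³]. -/
open MvPolynomial

open scoped Polynomial in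
/-- Scaling every variable by `T` multiplies a homogeneous polynomial of degree `n` by `T ^ n`. -/
theorem aeval_C_mul_X_of_isHomogeneous {K A σ : Type*} [CommRing K] [CommRing A] [Algebra K A]
    (a : σ → A) {n : ℕ} {P : MvPolynomial σ K} (hP : P.IsHomogeneous n) :
    aeval (fun i => (Polynomial.C (a i) * Polynomial.X : A[X])) P =
      Polynomial.C (aeval a P) * Polynomial.X ^ n := by
  conv_lhs => rw [P.as_sum]
  conv_rhs => rw [P.as_sum]
  rw [map_sum, map_sum, map_sum, Finset.sum_mul]
  refine Finset.sum_congr rfl fun d hd => ?_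
  have hdeg : d.degree = n := by
    rw [Finsupp.degree_eq_weight_one]
    exact hP (mem_support_iff.mp hd)
  rw [aeval_monomial, aeval_monomial, ← hdeg, Finsupp.degree_apply]
  simp only [Finsupp.prod, mul_pow, Finset.prod_mul_distrib, map_mul, map_prod, map_pow,
    Finset.prod_pow_eq_pow_sum, mul_assoc]
  rfl

/-- Let `K` be a field, `S = K[X,Y,Z]/(X³ − YZ(Y+Z))` with `x, y, z` the images
of the variables, and `R = K[x, y³, y²z, yz², z³] ⊆ S`.  Then every element of
`R` which is the image of a homogeneous polynomial of degree `3m` lies in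
`K[y³, y²z, yz², z³]`; that is, the third Veronese subring `R^{(3)}` of `R`
equals `K[y³, y²z, yz², z³]`. -/
theorem stmt_17 (K : Type*) [Field K]
    (I : Ideal (MvPolynomial (Fin 3) K))
    (hI : I = Ideal.span {X 0 ^ 3 - X 1 * X 2 * (X 1 + X 2)})
    (x y z : MvPolynomial (Fin 3) K ⧸ I)
    (hx : x = Ideal.Quotient.mk I (X 0))
    (hy : y = Ideal.Quotient.mk I (X 1))
    (hz : z = Ideal.Quotient.mk I (X 2))
    (R V : Subalgebra K (MvPolynomial (Fin 3) K ⧸ I))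
    (hR : R = Algebra.adjoin K {x, y ^ 3, y ^ 2 * z, y * z ^ 2, z ^ 3})
    (hV : V = Algebra.adjoin K {y ^ 3, y ^ 2 * z, y * z ^ 2, z ^ 3}) :
    ∀ (m : ℕ) (P : MvPolynomial (Fin 3) K), P.IsHomogeneous (3 * m) →
      Ideal.Quotient.mk I P ∈ R → Ideal.Quotient.mk I P ∈ V := by
  subst hI hx hy hz hR hV
  set I : Ideal (MvPolynomial (Fin 3) K) := Ideal.span {X 0 ^ 3 - X 1 * X 2 * (X 1 + X 2)}
  set a : Fin 3 → MvPolynomial (Fin 3) K ⧸ I := fun i => Ideal.Quotient.mk I (X i) with ha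
  change ∀ (m : ℕ) (P : MvPolynomial (Fin 3) K), P.IsHomogeneous (3 * m) →
    Ideal.Quotient.mk I P ∈ Algebra.adjoin K
      {a 0, a 1 ^ 3, a 1 ^ 2 * a 2, a 1 * a 2 ^ 2, a 2 ^ 3} →
    Ideal.Quotient.mk I P ∈ Algebra.adjoin K {a 1 ^ 3, a 1 ^ 2 * a 2, a 1 * a 2 ^ 2, a 2 ^ 3}
  set V := Algebra.adjoin K {a 1 ^ 3, a 1 ^ 2 * a 2, a 1 * a 2 ^ 2, a 2 ^ 3}
  have hrel : a 0 ^ 3 = a 1 * a 2 * (a 1 + a 2) := by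
    simp only [ha, ← map_pow, ← map_mul, ← map_add]
    exact Ideal.Quotient.eq.mpr (Ideal.subset_span rfl)
  have hmk : ∀ P, aeval a P = Ideal.Quotient.mk I P := by
    intro P
    have : aeval a = Ideal.Quotient.mkₐ K I := by
      ext i
      simp [ha]
    rw [this]
    rfl
  let φ := aeval (R := K)
    (fun i => (Polynomial.C (a i) * Polynomial.X : Polynomial (MvPolynomial (Fin 3) K ⧸ I)))
  have hφ : ∀ P ∈ I, φ P = 0 := by
    have : I ≤ RingHom.ker φ := by
      refine (Ideal.span_singleton_le_iff_mem _).mpr (RingHom.mem_ker.mpr ?_)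
      simp only [φ, map_sub, map_pow, map_mul, map_add, aeval_X]
      have h := congrArg Polynomial.C hrel
      simp only [map_pow, map_mul, map_add] at h
      linear_combination Polynomial.X ^ 3 * h
    exact fun P hP => this hP
  let ψ := Ideal.Quotient.liftₐ I φ hφ
  have hψ : ∀ P, ψ (Ideal.Quotient.mk I P) = φ P := fun P => rfl
  have hψa : ∀ i, ψ (a i) = Polynomial.C (a i) * Polynomial.X := fun i => by
    rw [ha, hψ]
    exact aeval_X _ _
  have hcube : a 0 ^ 3 ∈ V := by
    rw [hrel, show a 1 * a 2 * (a 1 + a 2) = a 1 ^ 2 * a 2 + a 1 * a 2 ^ 2 by ring]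
    exact add_mem (Algebra.subset_adjoin (by simp)) (Algebra.subset_adjoin (by simp))
  have hmon : ∀ s ∈ Submonoid.closure {a 0, a 1 ^ 3, a 1 ^ 2 * a 2, a 1 * a 2 ^ 2, a 2 ^ 3},
      ∃ k j v, v ∈ V ∧ s = a 0 ^ k * v ∧
        ψ s = Polynomial.C s * Polynomial.X ^ (k + 3 * j) := by
    intro s hs
    induction hs using Submonoid.closure_induction with
    | mem s hs =>
      rcases hs with rfl | hs
      · exact ⟨1, 0, 1, one_mem _, by simp, by simp [hψa]⟩
      · refine ⟨0, 1, s, Algebra.subset_adjoin hs, by simp, ?_⟩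
        rcases hs with rfl | rfl | rfl | rfl <;>
          simp only [map_mul, map_pow, hψa] <;> ring
    | one => exact ⟨0, 0, 1, one_mem _, by simp, by simp⟩
    | mul s t _ _ hs ht =>
      obtain ⟨k, j, v, hv, hs, hs'⟩ := hs
      obtain ⟨l, i, w, hw, ht, ht'⟩ := ht
      refine ⟨k + l, j + i, v * w, mul_mem hv hw, by rw [hs, ht]; ring, ?_⟩
      rw [map_mul, hs', ht', map_mul]
      ring
  have hcoeff : ∀ s ∈ Algebra.adjoin K {a 0, a 1 ^ 3, a 1 ^ 2 * a 2, a 1 * a 2 ^ 2, a 2 ^ 3},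
      ∀ m, (ψ s).coeff (3 * m) ∈ V := by
    intro s hs m
    rw [← Subalgebra.mem_toSubmodule, Algebra.adjoin_eq_span] at hs
    induction hs using Submodule.span_induction with
    | mem s hs =>
      obtain ⟨k, j, v, hv, hs, hs'⟩ := hmon s hs
      rw [hs', Polynomial.coeff_C_mul_X_pow]
      split_ifs with h
      · obtain ⟨l, rfl⟩ : 3 ∣ k := by omega
        rw [hs, pow_mul]
        exact mul_mem (pow_mem hcube l) hv
      · exact zero_mem _
    | zero => simp
    | add s t _ _ hs ht =>
      rw [map_add, Polynomial.coeff_add]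
      exact add_mem hs ht
    | smul c s _ hs =>
      rw [map_smul, Polynomial.coeff_smul]
      exact V.smul_mem hs c
  intro m P hP hPR
  have h := hcoeff _ hPR m
  rwa [hψ, aeval_C_mul_X_of_isHomogeneous a hP, Polynomial.coeff_C_mul_X_pow, if_pos rfl,
    hmk] at h
end
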